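/- arXiv:2508.06049 — 8 statements merged into one kernel-verified Lean document; each statement's English description precedes it below -/
import Mathlib

section
/- With j := L − ℓ, the norm of the error difference ẽ_ℓ := e ℓ − e L satisfies the two-sided bound in terms of the coarse-grid error: (1 − θ_ε^j) · ‖e ℓ‖ ≤ ‖e ℓ − e L‖ ≤ (1 + θ_ε^j) · ‖e ℓ‖. -/
/-- With `j = L - ℓ`, the norm of the error difference `e ℓ - e L` is bounded from
above and below in terms of the coarse-grid error norm. -/
theorem error_difference_coarse_bounds {V : Type*} [NormedAddCommGroup V]
    (L : ℕ) (e : ℕ → V) (θ ε : ℝ)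
    (hθ : 0 < θ) (hε : 0 < ε) (hθε : (1 + ε) * θ < 1)
    (ℓ : ℕ) (hℓ : ℓ ≤ L)
    (hconv : ∀ i : ℕ, ℓ ≤ i → i ≤ L →
      e (i - 1) ≠ 0 ∧ θ ≤ ‖e i‖ / ‖e (i - 1)‖ ∧ ‖e i‖ / ‖e (i - 1)‖ ≤ (1 + ε) * θ) :
    (1 - ((1 + ε) * θ) ^ (L - ℓ)) * ‖e ℓ‖ ≤ ‖e ℓ - e L‖ ∧
      ‖e ℓ - e L‖ ≤ (1 + ((1 + ε) * θ) ^ (L - ℓ)) * ‖e ℓ‖ := by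
  have hc : 0 ≤ (1 + ε) * θ := by positivity
  have hL : ‖e L‖ ≤ ((1 + ε) * θ) ^ (L - ℓ) * ‖e ℓ‖ := by
    have h := le_geom (u := fun k => ‖e (ℓ + k)‖) hc (L - ℓ) fun k hk => by
      obtain ⟨hne, -, hle⟩ := hconv (ℓ + (k + 1)) (by omega) (by omega)
      rw [show ℓ + (k + 1) - 1 = ℓ + k by omega] at hne hle
      exact (div_le_iff₀ (norm_pos_iff.mpr hne)).mp hle
    simpa only [Nat.add_sub_cancel' hℓ, Nat.add_zero] using h
  constructor
  · linarith [norm_sub_norm_le (e ℓ) (e L)]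
  · linarith [norm_sub_le (e ℓ) (e L)]
end

section
/- With j := L − ℓ (so 1 ≤ j), the estimated convergence factor θ̃ := ‖e ℓ − e L‖ / ‖e (ℓ−1) − e L‖ satisfies the two-sided bound θ · (1 − θ_ε^j)/(1 + θ_ε^(j+1)) ≤ θ̃ ≤ θ_ε · (1 + θ_ε^j)/(1 − θ_ε^(j+1)). -/
/-- With `j = L - ℓ`, the estimated convergence factor
`θ̃ = ‖e ℓ - e L‖ / ‖e (ℓ-1) - e L‖` satisfies a two-sided bound. -/
theorem estimated_convergence_factor_bounds {V : Type*} [NormedAddCommGroup V]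
    (L : ℕ) (e : ℕ → V) (θ ε : ℝ)
    (hθ : 0 < θ) (hε : 0 < ε) (hθε : (1 + ε) * θ < 1)
    (ℓ : ℕ) (hℓ1 : 1 ≤ ℓ) (hℓL : ℓ < L)
    (hconv : ∀ i : ℕ, ℓ ≤ i → i ≤ L →
      e (i - 1) ≠ 0 ∧ θ ≤ ‖e i‖ / ‖e (i - 1)‖ ∧ ‖e i‖ / ‖e (i - 1)‖ ≤ (1 + ε) * θ) :
    θ * (1 - ((1 + ε) * θ) ^ (L - ℓ)) / (1 + ((1 + ε) * θ) ^ (L - ℓ + 1)) ≤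
        ‖e ℓ - e L‖ / ‖e (ℓ - 1) - e L‖ ∧
      ‖e ℓ - e L‖ / ‖e (ℓ - 1) - e L‖ ≤
        (1 + ε) * θ * (1 + ((1 + ε) * θ) ^ (L - ℓ)) / (1 - ((1 + ε) * θ) ^ (L - ℓ + 1)) := by
  obtain ⟨m, rfl⟩ : ∃ m, ℓ = m + 1 := ⟨ℓ - 1, by omega⟩
  obtain ⟨j, rfl⟩ : ∃ j, L = m + 1 + j := ⟨L - (m + 1), by omega⟩
  have hj : j ≠ 0 := by omega
  simp only [Nat.add_sub_cancel_left, Nat.add_sub_cancel]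
  set q := (1 + ε) * θ
  have hq : 0 < q := by positivity
  have hstep : ∀ k ≤ j, 0 < ‖e (m + k)‖ ∧ θ * ‖e (m + k)‖ ≤ ‖e (m + k + 1)‖ ∧
      ‖e (m + k + 1)‖ ≤ q * ‖e (m + k)‖ := by
    intro k hk
    obtain ⟨h0, h1, h2⟩ := hconv (m + k + 1) (by omega) (by omega)
    rw [Nat.add_sub_cancel] at h0 h1 h2
    have hpos := norm_pos_iff.mpr h0
    exact ⟨hpos, (le_div_iff₀ hpos).mp h1, (div_le_iff₀ hpos).mp h2⟩
  obtain ⟨ha, hθa, hqa⟩ := hstep 0 (Nat.zero_le j)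
  have hdecay : ‖e (m + 1 + j)‖ ≤ q ^ j * ‖e (m + 1)‖ :=
    le_geom (u := fun k => ‖e (m + 1 + k)‖) hq.le j fun k hk => by
      have h := (hstep (k + 1) hk).2.2
      rwa [show m + (k + 1) = m + 1 + k by omega] at h
  simp only [Nat.add_zero] at ha hθa hqa
  have hdecay' : ‖e (m + 1 + j)‖ ≤ ‖e m‖ * q ^ (j + 1) :=
    calc ‖e (m + 1 + j)‖ ≤ q ^ j * ‖e (m + 1)‖ := hdecay
      _ ≤ q ^ j * (q * ‖e m‖) := by gcongr
      _ = ‖e m‖ * q ^ (j + 1) := by ring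
  have hqj : q ^ j < 1 := pow_lt_one₀ hq.le hθε hj
  have hqj' : q ^ (j + 1) < 1 := pow_lt_one₀ hq.le hθε j.succ_ne_zero
  have hnum_lower : ‖e m‖ * (θ * (1 - q ^ j)) ≤ ‖e (m + 1) - e (m + 1 + j)‖ := by
    have h := mul_le_mul_of_nonneg_right hθa (sub_nonneg.mpr hqj.le)
    linarith [norm_sub_norm_le (e (m + 1)) (e (m + 1 + j))]
  have hnum_upper : ‖e (m + 1) - e (m + 1 + j)‖ ≤ ‖e m‖ * (q * (1 + q ^ j)) := by
    have h := mul_le_mul_of_nonneg_right hqa (by positivity : 0 ≤ 1 + q ^ j)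
    linarith [norm_sub_le (e (m + 1)) (e (m + 1 + j))]
  have hden_lower : ‖e m‖ * (1 - q ^ (j + 1)) ≤ ‖e m - e (m + 1 + j)‖ := by
    linarith [norm_sub_norm_le (e m) (e (m + 1 + j))]
  have hden_upper : ‖e m - e (m + 1 + j)‖ ≤ ‖e m‖ * (1 + q ^ (j + 1)) := by
    linarith [norm_sub_le (e m) (e (m + 1 + j))]
  have hden_pos : 0 < ‖e m‖ * (1 - q ^ (j + 1)) := mul_pos ha (sub_pos.mpr hqj')
  constructor
  · rw [← mul_div_mul_left _ _ ha.ne']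
    exact div_le_div₀ (norm_nonneg _) hnum_lower (hden_pos.trans_le hden_lower) hden_upper
  · rw [← mul_div_mul_left (q * (1 + q ^ j)) _ ha.ne']
    exact div_le_div₀ (by positivity) hnum_upper hden_pos hden_lower
end

section
/- With j := L − ℓ (so 1 ≤ j), the error estimate η_j := θ̃^j · ‖e ℓ − e L‖, where θ̃ := ‖e ℓ − e L‖ / ‖e (ℓ−1) − e L‖, satisfies the sharp two-sided bound ((1+ε)^(−j) − θ^j) · ((1 − θ_ε^j)/(1 + θ_ε^(j+1)))^j · ‖e L‖ ≤ η_j ≤ ((1+ε)^j + θ_ε^j) · ((1 + θ_ε^j)/(1 − θ_ε^(j+1)))^j · ‖e L‖. -/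
/-- If consecutive terms of a sequence grow by factors between `a` and `b`, then its `k`-th term lies
between the corresponding geometric multiples of its first term. -/
theorem pow_mul_le_and_le_pow_mul {u : ℕ → ℝ} {a b : ℝ} (ha : 0 ≤ a) (hb : 0 ≤ b) (k : ℕ)
    (h : ∀ i < k, a * u i ≤ u (i + 1) ∧ u (i + 1) ≤ b * u i) :
    a ^ k * u 0 ≤ u k ∧ u k ≤ b ^ k * u 0 := by
  induction k with
  | zero => simp
  | succ k ih =>
    obtain ⟨h1, h2⟩ := ih fun i hi => h i (by omega)
    obtain ⟨h3, h4⟩ := h k (by omega)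
    rw [pow_succ', pow_succ', mul_assoc, mul_assoc]
    exact ⟨(mul_le_mul_of_nonneg_left h1 ha).trans h3,
      h4.trans (mul_le_mul_of_nonneg_left h2 hb)⟩

/-- With `j = L - ℓ`, the error estimate `η_j = θ̃^j * ‖e ℓ - e L‖`, where
`θ̃ = ‖e ℓ - e L‖ / ‖e (ℓ-1) - e L‖`, satisfies a sharp two-sided bound
in terms of the fine-grid error norm. -/
theorem eta_sharp_bounds {V : Type*} [NormedAddCommGroup V]
    (L : ℕ) (e : ℕ → V) (θ ε : ℝ)
    (hθ : 0 < θ) (hε : 0 < ε) (hθε : (1 + ε) * θ < 1)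
    (ℓ : ℕ) (hℓ1 : 1 ≤ ℓ) (hℓL : ℓ < L)
    (hconv : ∀ i : ℕ, ℓ ≤ i → i ≤ L →
      e (i - 1) ≠ 0 ∧ θ ≤ ‖e i‖ / ‖e (i - 1)‖ ∧ ‖e i‖ / ‖e (i - 1)‖ ≤ (1 + ε) * θ)
    (j : ℕ) (hj : j = L - ℓ)
    (η : ℝ) (hη : η = (‖e ℓ - e L‖ / ‖e (ℓ - 1) - e L‖) ^ j * ‖e ℓ - e L‖) :
    (((1 + ε) ^ j)⁻¹ - θ ^ j) *
        ((1 - ((1 + ε) * θ) ^ j) / (1 + ((1 + ε) * θ) ^ (j + 1))) ^ j * ‖e L‖ ≤ η ∧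
      η ≤ ((1 + ε) ^ j + ((1 + ε) * θ) ^ j) *
        ((1 + ((1 + ε) * θ) ^ j) / (1 - ((1 + ε) * θ) ^ (j + 1))) ^ j * ‖e L‖ := by
  have h1ε : 0 < 1 + ε := by linarith
  obtain ⟨m, rfl⟩ : ∃ m, ℓ = m + 1 := ⟨ℓ - 1, by omega⟩
  obtain rfl : L = m + 1 + j := by omega
  have hj0 : j ≠ 0 := by omega
  subst hη
  rw [Nat.add_sub_cancel]
  set t := (1 + ε) * θ with ht
  have ht0 : 0 < t := mul_pos h1ε hθ
  have hstep : ∀ i ≤ j, θ * ‖e (m + i)‖ ≤ ‖e (m + i + 1)‖ ∧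
      ‖e (m + i + 1)‖ ≤ t * ‖e (m + i)‖ := by
    intro i hi
    obtain ⟨h0, h1, h2⟩ := hconv (m + i + 1) (by omega) (by omega)
    rw [Nat.add_sub_cancel] at h0 h1 h2
    have hpos := norm_pos_iff.mpr h0
    exact ⟨(le_div_iff₀ hpos).mp h1, (div_le_iff₀ hpos).mp h2⟩
  have hm : 0 < ‖e m‖ := norm_pos_iff.mpr (hconv (m + 1) le_rfl (by omega)).1
  obtain ⟨hx1, hx2⟩ := hstep 0 (by omega)
  simp only [Nat.add_zero] at hx1 hx2
  have hz1 := (pow_mul_le_and_le_pow_mul (u := fun i => ‖e (m + i)‖) hθ.le ht0.le (j + 1)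
    fun i hi => hstep i (by omega)).2
  obtain ⟨hy1, hy2⟩ := pow_mul_le_and_le_pow_mul (u := fun i => ‖e (m + 1 + i)‖) hθ.le ht0.le j
    fun i hi => by
      have := hstep (i + 1) (by omega)
      rwa [show m + (i + 1) = m + 1 + i by omega] at this
  simp only [Nat.add_zero] at hy1 hy2 hz1
  rw [show m + (j + 1) = m + 1 + j by omega] at hz1
  have u1 := norm_sub_le (e (m + 1)) (e (m + 1 + j))
  have l1 := norm_sub_norm_le (e (m + 1)) (e (m + 1 + j))
  have u2 := norm_sub_le (e m) (e (m + 1 + j))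
  have l2 := norm_sub_norm_le (e m) (e (m + 1 + j))
  have hzn := norm_nonneg (e (m + 1 + j))
  have hpn := norm_nonneg (e (m + 1) - e (m + 1 + j))
  set a := ‖e m‖
  set x := ‖e (m + 1)‖
  set z := ‖e (m + 1 + j)‖
  set p := ‖e (m + 1) - e (m + 1 + j)‖
  set q := ‖e m - e (m + 1 + j)‖
  have hT : t ^ j < 1 := pow_lt_one₀ ht0.le hθε hj0
  have hS : t ^ (j + 1) < 1 := pow_lt_one₀ ht0.le hθε (by omega)
  have hT0 : 0 < t ^ j := by positivity
  have hS0 : 0 < t ^ (j + 1) := by positivity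
  have hθj : 0 < θ ^ j := by positivity
  have hεj : 0 < (1 + ε) ^ j := by positivity
  have htj : t ^ j = (1 + ε) ^ j * θ ^ j := mul_pow _ _ _
  have hq : 0 < q := by nlinarith
  have hr0 : 0 ≤ (1 - t ^ j) / (1 + t ^ (j + 1)) := div_nonneg (by linarith) (by linarith)
  have hlow : θ * ((1 - t ^ j) / (1 + t ^ (j + 1))) ≤ p / q := by
    rw [← mul_div_assoc, div_le_div_iff₀ (by linarith) hq]
    calc θ * (1 - t ^ j) * q ≤ θ * (1 - t ^ j) * (a * (1 + t ^ (j + 1))) :=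
          mul_le_mul_of_nonneg_left (by linarith) (mul_nonneg hθ.le (by linarith))
      _ = (θ * a) * (1 - t ^ j) * (1 + t ^ (j + 1)) := by ring
      _ ≤ x * (1 - t ^ j) * (1 + t ^ (j + 1)) := by
          gcongr
      _ ≤ p * (1 + t ^ (j + 1)) := by
          gcongr
          linarith
  have hupp : p / q ≤ t * ((1 + t ^ j) / (1 - t ^ (j + 1))) := by
    rw [← mul_div_assoc, div_le_div_iff₀ hq (by linarith)]
    have hS' : 0 ≤ 1 - t ^ (j + 1) := by linarith
    calc p * (1 - t ^ (j + 1)) ≤ x * (1 + t ^ j) * (1 - t ^ (j + 1)) := by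
          gcongr
          linarith
      _ ≤ t * a * (1 + t ^ j) * (1 - t ^ (j + 1)) := by gcongr
      _ = t * (1 + t ^ j) * (a * (1 - t ^ (j + 1))) := by ring
      _ ≤ t * (1 + t ^ j) * q := by
          gcongr
          linarith
  have hlowj := pow_le_pow_left₀ (mul_nonneg hθ.le hr0) hlow j
  have huppj := pow_le_pow_left₀ (div_nonneg hpn hq.le) hupp j
  rw [mul_pow] at hlowj huppj
  constructor
  · have key : (((1 + ε) ^ j)⁻¹ - θ ^ j) * z ≤ θ ^ j * p := by
      have : ((1 + ε) ^ j)⁻¹ * z ≤ θ ^ j * x := by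
        rw [inv_mul_le_iff₀ hεj, ← mul_assoc, ← htj]
        exact hy2
      nlinarith
    calc _ = (((1 + ε) ^ j)⁻¹ - θ ^ j) * z * ((1 - t ^ j) / (1 + t ^ (j + 1))) ^ j := by ring
      _ ≤ θ ^ j * p * ((1 - t ^ j) / (1 + t ^ (j + 1))) ^ j := by gcongr
      _ = θ ^ j * ((1 - t ^ j) / (1 + t ^ (j + 1))) ^ j * p := by ring
      _ ≤ (p / q) ^ j * p := by gcongr
  · have hR0 : 0 ≤ (1 + t ^ j) / (1 - t ^ (j + 1)) := div_nonneg (by linarith) (by linarith)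
    have key : t ^ j * p ≤ ((1 + ε) ^ j + t ^ j) * z := by
      have : t ^ j * x ≤ (1 + ε) ^ j * z := by
        rw [htj, mul_assoc]
        gcongr
      nlinarith
    calc (p / q) ^ j * p ≤ t ^ j * ((1 + t ^ j) / (1 - t ^ (j + 1))) ^ j * p := by gcongr
      _ = t ^ j * p * ((1 + t ^ j) / (1 - t ^ (j + 1))) ^ j := by ring
      _ ≤ ((1 + ε) ^ j + t ^ j) * z * ((1 + t ^ j) / (1 - t ^ (j + 1))) ^ j := by gcongr
      _ = _ := by ring
end

section
/- (Main theorem on effectivity of the global error estimate.) With j := L − ℓ (so 1 ≤ j), the error estimate η_j := θ̃^j · ‖e ℓ − e L‖, where θ̃ := ‖e ℓ − e L‖ / ‖e (ℓ−1) − e L‖, is equivalent to the fine-grid error norm: C₁ · ‖e L‖ ≤ η_j ≤ C₂ · ‖e L‖, where C₁ = (1+ε)^(−j) · (1 − θ_ε^j)^(j+1) / (1 + θ_ε^(j+1))^j and C₂ = (1+ε)^j · (1 + θ_ε^j)^(j+1) / (1 − θ_ε^(j+1))^j. -/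
theorem div_pow_mul_self_mono {x y x' y' : ℝ} (hx : 0 ≤ x) (hxx : x ≤ x')
    (hy : 0 < y') (hyy : y' ≤ y) (j : ℕ) :
    (x / y) ^ j * x ≤ (x' / y') ^ j * x' := by
  have hx' : 0 ≤ x' := hx.trans hxx
  have hpos : 0 < y := hy.trans_le hyy
  gcongr

theorem div_pow_mul_self_mul (P Q a b : ℝ) (j : ℕ) :
    (P * a / (Q * b)) ^ j * (P * a) = P ^ (j + 1) / Q ^ j * ((a / b) ^ j * a) := by
  rw [mul_div_mul_comm, mul_pow, div_pow P Q, pow_succ]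
  ring

/-- If `‖w‖ ≤ r * ‖v‖`, then `‖v - w‖` is equivalent to `‖v‖`. -/
theorem norm_sub_bounds {V : Type*} [NormedAddCommGroup V] {v w : V} {r : ℝ}
    (h : ‖w‖ ≤ r * ‖v‖) :
    (1 - r) * ‖v‖ ≤ ‖v - w‖ ∧ ‖v - w‖ ≤ (1 + r) * ‖v‖ := by
  have h₁ := norm_sub_norm_le v w
  have h₂ := norm_sub_le v w
  constructor <;> linarith

/-- Main theorem on the effectivity of the global error estimate: with `j = L - ℓ`,
the estimate `η_j = θ̃^j * ‖e ℓ - e L‖` is equivalent to the fine-grid error norm,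
with explicit constants `C₁` and `C₂`. -/
theorem eta_equivalent_to_error {V : Type*} [NormedAddCommGroup V]
    (L : ℕ) (e : ℕ → V) (θ ε : ℝ)
    (hθ : 0 < θ) (hε : 0 < ε) (hθε : (1 + ε) * θ < 1)
    (ℓ : ℕ) (hℓ1 : 1 ≤ ℓ) (hℓL : ℓ < L)
    (hconv : ∀ i : ℕ, ℓ ≤ i → i ≤ L →
      e (i - 1) ≠ 0 ∧ θ ≤ ‖e i‖ / ‖e (i - 1)‖ ∧ ‖e i‖ / ‖e (i - 1)‖ ≤ (1 + ε) * θ)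
    (j : ℕ) (hj : j = L - ℓ)
    (η : ℝ) (hη : η = (‖e ℓ - e L‖ / ‖e (ℓ - 1) - e L‖) ^ j * ‖e ℓ - e L‖)
    (C₁ C₂ : ℝ)
    (hC₁ : C₁ = ((1 + ε) ^ j)⁻¹ *
      (1 - ((1 + ε) * θ) ^ j) ^ (j + 1) / (1 + ((1 + ε) * θ) ^ (j + 1)) ^ j)
    (hC₂ : C₂ = (1 + ε) ^ j *
      (1 + ((1 + ε) * θ) ^ j) ^ (j + 1) / (1 - ((1 + ε) * θ) ^ (j + 1)) ^ j) :
    C₁ * ‖e L‖ ≤ η ∧ η ≤ C₂ * ‖e L‖ := by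
  obtain ⟨m, rfl⟩ : ∃ m, ℓ = m + 1 := ⟨ℓ - 1, by omega⟩
  obtain rfl : L = m + 1 + j := by omega
  have hj0 : j ≠ 0 := by omega
  clear hj
  rw [Nat.add_sub_cancel] at hη
  have hε1 : 0 < 1 + ε := by linarith
  have hq : 0 < (1 + ε) * θ := mul_pos hε1 hθ
  have hb : 0 < ‖e m‖ := norm_pos_iff.2 (hconv (m + 1) le_rfl (by omega)).1
  have ha : 0 < ‖e (m + 1)‖ := norm_pos_iff.2 (hconv (m + 2) (by omega) (by omega)).1
  have hab := (hconv (m + 1) le_rfl (by omega)).2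
  rw [Nat.add_sub_cancel] at hab
  have hstep : ∀ k < j, θ * ‖e (m + 1 + k)‖ ≤ ‖e (m + 1 + (k + 1))‖ ∧
      ‖e (m + 1 + (k + 1))‖ ≤ (1 + ε) * θ * ‖e (m + 1 + k)‖ := by
    intro k hk
    obtain ⟨h0, h1, h2⟩ := hconv (m + 1 + (k + 1)) (by omega) (by omega)
    rw [← add_assoc, Nat.add_sub_cancel] at h0 h1 h2
    have hpos := norm_pos_iff.2 h0
    exact ⟨(le_div_iff₀ hpos).1 h1, (div_le_iff₀ hpos).1 h2⟩
  have hlow : θ ^ j * ‖e (m + 1)‖ ≤ ‖e (m + 1 + j)‖ :=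
    geom_le (u := fun k => ‖e (m + 1 + k)‖) hθ.le j fun k hk => (hstep k hk).1
  have hupp : ‖e (m + 1 + j)‖ ≤ ((1 + ε) * θ) ^ j * ‖e (m + 1)‖ :=
    le_geom (u := fun k => ‖e (m + 1 + k)‖) hq.le j fun k hk => (hstep k hk).2
  have hupp' : ‖e (m + 1 + j)‖ ≤ ((1 + ε) * θ) ^ (j + 1) * ‖e m‖ := by
    rw [pow_succ, mul_assoc]
    exact hupp.trans (by gcongr; exact (div_le_iff₀ hb).1 hab.2)
  obtain ⟨hx1, hx2⟩ := norm_sub_bounds hupp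
  obtain ⟨hy1, hy2⟩ := norm_sub_bounds hupp'
  have hP : 0 < 1 - ((1 + ε) * θ) ^ j := sub_pos.2 (pow_lt_one₀ hq.le hθε hj0)
  have hQ : 0 < 1 - ((1 + ε) * θ) ^ (j + 1) :=
    sub_pos.2 (pow_lt_one₀ hq.le hθε j.succ_ne_zero)
  have hθq : ((1 + ε) * θ) ^ j = (1 + ε) ^ j * θ ^ j := mul_pow _ _ _
  rw [hη, hC₁, hC₂]
  constructor
  · refine le_trans ?_ (div_pow_mul_self_mono (mul_pos hP ha).le hx1
      ((mul_pos hQ hb).trans_le hy1) hy2 j)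
    rw [div_pow_mul_self_mul, mul_div_assoc, mul_comm (((1 + ε) ^ j)⁻¹), mul_assoc]
    refine mul_le_mul_of_nonneg_left ?_ (by positivity)
    calc ((1 + ε) ^ j)⁻¹ * ‖e (m + 1 + j)‖
        ≤ ((1 + ε) ^ j)⁻¹ * (((1 + ε) * θ) ^ j * ‖e (m + 1)‖) := by gcongr
      _ = θ ^ j * ‖e (m + 1)‖ := by
        rw [hθq]
        field_simp
      _ ≤ (‖e (m + 1)‖ / ‖e m‖) ^ j * ‖e (m + 1)‖ := by
        gcongr
        exact hab.1
  · refine (div_pow_mul_self_mono (norm_nonneg _) hx2 (mul_pos hQ hb) hy1 j).trans ?_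
    rw [div_pow_mul_self_mul, mul_div_assoc, mul_comm ((1 + ε) ^ j), mul_assoc]
    refine mul_le_mul_of_nonneg_left ?_ (by positivity)
    calc (‖e (m + 1)‖ / ‖e m‖) ^ j * ‖e (m + 1)‖
        ≤ ((1 + ε) * θ) ^ j * ‖e (m + 1)‖ := by
          gcongr
          exact hab.2
      _ = (1 + ε) ^ j * (θ ^ j * ‖e (m + 1)‖) := by rw [hθq, mul_assoc]
      _ ≤ (1 + ε) ^ j * ‖e (m + 1 + j)‖ := by gcongr
end

section
/- (Effectivity spread of the scaled local error indicator.) Define for each T ∈ 𝒯 the local effectivity index γ T := θ̃_T^j · ‖ẽ_{ℓ,T}‖ / ‖e_T L‖. Then (max over T of γ T) / (min over T of γ T) ≤ (1+ε)^(2j) · ((1 + θ_max^(j+1)) / (1 − θ_max^(j+1)))^j · ((1 + θ_max^j) / (1 − θ_max^j))^(j+1). -/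
/-- A sequence whose consecutive ratios lie in `[a, b]` is squeezed between geometric sequences. -/
lemma geometric_bounds_of_ratio_bounds {u : ℕ → ℝ} {a b : ℝ} (ha : 0 ≤ a) (hb : 0 ≤ b) {n : ℕ}
    (h : ∀ k < n, a * u k ≤ u (k + 1) ∧ u (k + 1) ≤ b * u k) :
    a ^ n * u 0 ≤ u n ∧ u n ≤ b ^ n * u 0 := by
  induction n with
  | zero => simp
  | succ n ih =>
    obtain ⟨hl, hu⟩ := ih fun k hk => h k (by omega)
    obtain ⟨hl', hu'⟩ := h n (by omega)
    constructor
    · calc a ^ (n + 1) * u 0 = a * (a ^ n * u 0) := by ring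
        _ ≤ a * u n := by gcongr
        _ ≤ u (n + 1) := hl'
    · calc u (n + 1) ≤ b * u n := hu'
        _ ≤ b * (b ^ n * u 0) := by gcongr
        _ = b ^ (n + 1) * u 0 := by ring

/-- If `‖z‖ ≤ c * ‖x‖` then `‖x - z‖` is comparable to `‖x‖`. -/
lemma norm_sub_bounds_of_norm_le_mul {V : Type*} [SeminormedAddCommGroup V] {x z : V} {c : ℝ}
    (h : ‖z‖ ≤ c * ‖x‖) : (1 - c) * ‖x‖ ≤ ‖x - z‖ ∧ ‖x - z‖ ≤ (1 + c) * ‖x‖ :=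
  ⟨by linarith [norm_sub_norm_le x z], by linarith [norm_sub_le x z]⟩

/-- Two-sided bounds for a single effectivity index of the scaled indicator, where `x`, `y`, `z`
are the errors on the levels `ℓ - 1`, `ℓ` and `ℓ + j`. -/
lemma scaled_indicator_effectivity_bounds {V : Type*} [SeminormedAddCommGroup V] {x y z : V}
    {t K m : ℝ} {j : ℕ} (hj : j ≠ 0) (ht : 0 < t) (hK : 0 < K) (hm : K * t ≤ m) (hm1 : m < 1)
    (hx : 0 < ‖x‖) (hxy : t * ‖x‖ ≤ ‖y‖) (hyx : ‖y‖ ≤ K * t * ‖x‖)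
    (hyz : t ^ j * ‖y‖ ≤ ‖z‖) (hzy : ‖z‖ ≤ (K * t) ^ j * ‖y‖) :
    (1 - m ^ j) ^ (j + 1) / (K ^ j * (1 + m ^ (j + 1)) ^ j) ≤
        (‖y - z‖ / ‖x - z‖) ^ j * ‖y - z‖ / ‖z‖ ∧
      (‖y - z‖ / ‖x - z‖) ^ j * ‖y - z‖ / ‖z‖ ≤
        K ^ j * (1 + m ^ j) ^ (j + 1) / (1 - m ^ (j + 1)) ^ j := by
  have hKt : 0 < K * t := mul_pos hK ht
  have hm0 : 0 < m := hKt.trans_le hm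
  have hy : 0 < ‖y‖ := (mul_pos ht hx).trans_le hxy
  have hz : 0 < ‖z‖ := (by positivity : 0 < t ^ j * ‖y‖).trans_le hyz
  have hzx : ‖z‖ ≤ m ^ (j + 1) * ‖x‖ :=
    calc ‖z‖ ≤ (K * t) ^ j * (K * t * ‖x‖) := hzy.trans (by gcongr)
      _ = (K * t) ^ (j + 1) * ‖x‖ := by ring
      _ ≤ m ^ (j + 1) * ‖x‖ := by gcongr
  obtain ⟨hyl, hyu⟩ := norm_sub_bounds_of_norm_le_mul (hzy.trans (by gcongr : _ ≤ m ^ j * ‖y‖))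
  obtain ⟨hxl, hxu⟩ := norm_sub_bounds_of_norm_le_mul hzx
  have hM : 0 < 1 - m ^ j := sub_pos.2 (pow_lt_one₀ hm0.le hm1 hj)
  have hM' : 0 < 1 - m ^ (j + 1) := sub_pos.2 (pow_lt_one₀ hm0.le hm1 j.succ_ne_zero)
  have hxz : 0 < ‖x - z‖ := (mul_pos hM' hx).trans_le hxl
  rw [mul_div_assoc]
  constructor
  · have hs : t * (1 - m ^ j) / (1 + m ^ (j + 1)) ≤ ‖y - z‖ / ‖x - z‖ := by
      rw [div_le_div_iff₀ (by positivity) hxz]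
      calc t * (1 - m ^ j) * ‖x - z‖
          ≤ t * (1 - m ^ j) * ((1 + m ^ (j + 1)) * ‖x‖) := by gcongr
        _ = (1 - m ^ j) * (t * ‖x‖) * (1 + m ^ (j + 1)) := by ring
        _ ≤ (1 - m ^ j) * ‖y‖ * (1 + m ^ (j + 1)) := by gcongr
        _ ≤ ‖y - z‖ * (1 + m ^ (j + 1)) := by gcongr
    have hr : (1 - m ^ j) / (K * t) ^ j ≤ ‖y - z‖ / ‖z‖ := by
      rw [div_le_div_iff₀ (by positivity) hz]
      calc (1 - m ^ j) * ‖z‖ ≤ (1 - m ^ j) * ((K * t) ^ j * ‖y‖) := by gcongr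
        _ = (1 - m ^ j) * ‖y‖ * (K * t) ^ j := by ring
        _ ≤ ‖y - z‖ * (K * t) ^ j := by gcongr
    calc (1 - m ^ j) ^ (j + 1) / (K ^ j * (1 + m ^ (j + 1)) ^ j)
        = (t * (1 - m ^ j) / (1 + m ^ (j + 1))) ^ j * ((1 - m ^ j) / (K * t) ^ j) := by
          rw [div_pow, mul_pow, mul_pow]
          field_simp
          ring
      _ ≤ _ := by gcongr
  · have hs : ‖y - z‖ / ‖x - z‖ ≤ K * t * (1 + m ^ j) / (1 - m ^ (j + 1)) := by
      rw [div_le_div_iff₀ hxz hM']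
      calc ‖y - z‖ * (1 - m ^ (j + 1))
          ≤ (1 + m ^ j) * ‖y‖ * (1 - m ^ (j + 1)) := by gcongr
        _ ≤ (1 + m ^ j) * (K * t * ‖x‖) * (1 - m ^ (j + 1)) := by gcongr
        _ = K * t * (1 + m ^ j) * ((1 - m ^ (j + 1)) * ‖x‖) := by ring
        _ ≤ K * t * (1 + m ^ j) * ‖x - z‖ := by gcongr
    have hr : ‖y - z‖ / ‖z‖ ≤ (1 + m ^ j) / t ^ j := by
      rw [div_le_div_iff₀ hz (by positivity)]
      calc ‖y - z‖ * t ^ j ≤ (1 + m ^ j) * ‖y‖ * t ^ j := by gcongr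
        _ = (1 + m ^ j) * (t ^ j * ‖y‖) := by ring
        _ ≤ (1 + m ^ j) * ‖z‖ := by gcongr
    calc (‖y - z‖ / ‖x - z‖) ^ j * (‖y - z‖ / ‖z‖)
        ≤ (K * t * (1 + m ^ j) / (1 - m ^ (j + 1))) ^ j * ((1 + m ^ j) / t ^ j) := by gcongr
      _ = K ^ j * (1 + m ^ j) ^ (j + 1) / (1 - m ^ (j + 1)) ^ j := by
          rw [div_pow, mul_pow, mul_pow]
          field_simp
          ring


/-- Effectivity spread of the scaled local error indicator `η_{j,T} = θ̃_T^j * ‖ẽ_{ℓ,T}‖`: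
the spread of the local effectivity indices `γ T = η_{j,T} / ‖e_T L‖` is bounded in
terms of the worst local convergence factor `θ_max`. -/
theorem scaled_local_indicator_spread {V : Type*} [NormedAddCommGroup V]
    {ι : Type*} [Fintype ι] [Nonempty ι]
    (L : ℕ) (e : ι → ℕ → V) (ε : ℝ) (hε : 0 < ε)
    (θ : ι → ℝ) (hθ : ∀ T, 0 < θ T) (hθε : ∀ T, (1 + ε) * θ T < 1)
    (j : ℕ) (hj1 : 1 ≤ j) (hjL : j < L)
    (ℓ : ℕ) (hℓ : ℓ = L - j)
    (hconv : ∀ T, ∀ i : ℕ, ℓ ≤ i → i ≤ L →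
      e T (i - 1) ≠ 0 ∧ θ T ≤ ‖e T i‖ / ‖e T (i - 1)‖ ∧
        ‖e T i‖ / ‖e T (i - 1)‖ ≤ (1 + ε) * θ T)
    (θmax : ℝ) (hθmax : θmax = (1 + ε) * Finset.univ.sup' Finset.univ_nonempty θ)
    (γ : ι → ℝ)
    (hγ : ∀ T, γ T = (‖e T ℓ - e T L‖ / ‖e T (ℓ - 1) - e T L‖) ^ j *
      ‖e T ℓ - e T L‖ / ‖e T L‖) :
    (Finset.univ.sup' Finset.univ_nonempty γ) /
        (Finset.univ.inf' Finset.univ_nonempty γ) ≤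
      (1 + ε) ^ (2 * j) *
        ((1 + θmax ^ (j + 1)) / (1 - θmax ^ (j + 1))) ^ j *
        ((1 + θmax ^ j) / (1 - θmax ^ j)) ^ (j + 1) := by
  have hK : 0 < 1 + ε := by linarith
  have hm : ∀ T, (1 + ε) * θ T ≤ θmax := fun T => by
    rw [hθmax]
    gcongr
    exact Finset.le_sup' θ (Finset.mem_univ T)
  have hm1 : θmax < 1 := by
    obtain ⟨T, -, hT⟩ := Finset.exists_mem_eq_sup' Finset.univ_nonempty θ
    rw [hθmax, hT]
    exact hθε T
  have hm0 : 0 < θmax := by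
    obtain ⟨T⟩ := ‹Nonempty ι›
    exact (mul_pos hK (hθ T)).trans_le (hm T)
  have hj : j ≠ 0 := by omega
  have hM : 0 < 1 - θmax ^ j := sub_pos.2 (pow_lt_one₀ hm0.le hm1 hj)
  have hM' : 0 < 1 - θmax ^ (j + 1) := sub_pos.2 (pow_lt_one₀ hm0.le hm1 j.succ_ne_zero)
  have hstep : ∀ T i, ℓ ≤ i → i ≤ L →
      θ T * ‖e T (i - 1)‖ ≤ ‖e T i‖ ∧ ‖e T i‖ ≤ (1 + ε) * θ T * ‖e T (i - 1)‖ := by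
    intro T i hi hiL
    obtain ⟨hne, hl, hu⟩ := hconv T i hi hiL
    have hpos := norm_pos_iff.2 hne
    exact ⟨(le_div_iff₀ hpos).1 hl, (div_le_iff₀ hpos).1 hu⟩
  have hbounds : ∀ T,
      (1 - θmax ^ j) ^ (j + 1) / ((1 + ε) ^ j * (1 + θmax ^ (j + 1)) ^ j) ≤ γ T ∧
        γ T ≤ (1 + ε) ^ j * (1 + θmax ^ j) ^ (j + 1) / (1 - θmax ^ (j + 1)) ^ j := by
    intro T
    have hgeom := geometric_bounds_of_ratio_bounds (u := fun k => ‖e T (ℓ + k)‖) (n := j)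
      (hθ T).le (mul_pos hK (hθ T)).le
      fun k hk => hstep T (ℓ + (k + 1)) (by omega) (by omega)
    have hL : ℓ + j = L := by omega
    simp only [add_zero, hL] at hgeom
    obtain ⟨hl, hu⟩ := hstep T ℓ le_rfl (by omega)
    rw [hγ T]
    exact scaled_indicator_effectivity_bounds hj (hθ T) hK (hm T) hm1
      (norm_pos_iff.2 (hconv T ℓ le_rfl (by omega)).1) hl hu hgeom.1 hgeom.2
  calc Finset.univ.sup' Finset.univ_nonempty γ / Finset.univ.inf' Finset.univ_nonempty γ
      ≤ ((1 + ε) ^ j * (1 + θmax ^ j) ^ (j + 1) / (1 - θmax ^ (j + 1)) ^ j) /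
          ((1 - θmax ^ j) ^ (j + 1) / ((1 + ε) ^ j * (1 + θmax ^ (j + 1)) ^ j)) :=
        div_le_div₀ (by positivity) (Finset.sup'_le _ _ fun T _ => (hbounds T).2)
          (by positivity) (Finset.le_inf' _ _ fun T _ => (hbounds T).1)
    _ = _ := by
        rw [div_pow, div_pow]
        field_simp
        ring
end

section
/- (Effectivity spread of the unscaled local error indicator.) Define for each T ∈ 𝒯 the local effectivity index γ' T := ‖ẽ_{ℓ,T}‖ / ‖e_T L‖. Then (max over T of γ' T) / (min over T of γ' T) ≤ (θ_min^(−j) + 1) / (θ_max^(−j) − 1), where θ_min^(−j) denotes (θ_min^j)⁻¹ and θ_max^(−j) denotes (θ_max^j)⁻¹. -/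
/-- If the consecutive ratios of `‖u k‖` lie in `[a, b]` for `n` steps, then the relative distance
between `u 0` and `u n` lies in `[(b ^ n)⁻¹ - 1, (a ^ n)⁻¹ + 1]`. -/
theorem norm_sub_div_norm_mem_Icc_of_ratio_bounds {V : Type*} [NormedAddCommGroup V]
    {u : ℕ → V} {a b : ℝ} {n : ℕ} (ha : 0 < a) (hb : 0 < b) (hu : u n ≠ 0)
    (hlow : ∀ k < n, a * ‖u k‖ ≤ ‖u (k + 1)‖) (hupp : ∀ k < n, ‖u (k + 1)‖ ≤ b * ‖u k‖) :
    ‖u 0 - u n‖ / ‖u n‖ ∈ Set.Icc ((b ^ n)⁻¹ - 1) ((a ^ n)⁻¹ + 1) := by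
  have hpos : 0 < ‖u n‖ := norm_pos_iff.mpr hu
  have h_low : a ^ n * ‖u 0‖ ≤ ‖u n‖ := geom_le (u := fun k => ‖u k‖) ha.le n hlow
  have h_upp : ‖u n‖ ≤ b ^ n * ‖u 0‖ := le_geom (u := fun k => ‖u k‖) hb.le n hupp
  constructor
  · rw [le_div_iff₀ hpos, sub_mul, one_mul]
    have : (b ^ n)⁻¹ * ‖u n‖ ≤ ‖u 0‖ := (inv_mul_le_iff₀ (by positivity)).mpr h_upp
    linarith [norm_sub_norm_le (u 0) (u n)]
  · rw [div_le_iff₀ hpos, add_mul, one_mul]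
    have : ‖u 0‖ ≤ (a ^ n)⁻¹ * ‖u n‖ := (le_inv_mul_iff₀ (by positivity)).mpr h_low
    linarith [norm_sub_le (u 0) (u n)]

/-- Effectivity spread of the unscaled local error indicator `η'_{j,T} = ‖ẽ_{ℓ,T}‖`:
the spread of the local effectivity indices `γ' T = ‖ẽ_{ℓ,T}‖ / ‖e_T L‖` is bounded
by `(θ_min^(-j) + 1) / (θ_max^(-j) - 1)`. -/
theorem unscaled_local_indicator_spread {V : Type*} [NormedAddCommGroup V]
    {ι : Type*} [Fintype ι] [Nonempty ι]
    (L : ℕ) (e : ι → ℕ → V) (ε : ℝ) (hε : 0 < ε)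
    (θ : ι → ℝ) (hθ : ∀ T, 0 < θ T) (hθε : ∀ T, (1 + ε) * θ T < 1)
    (j : ℕ) (hj1 : 1 ≤ j) (hjL : j < L)
    (ℓ : ℕ) (hℓ : ℓ = L - j)
    (hconv : ∀ T, ∀ i : ℕ, ℓ ≤ i → i ≤ L →
      e T (i - 1) ≠ 0 ∧ θ T ≤ ‖e T i‖ / ‖e T (i - 1)‖ ∧
        ‖e T i‖ / ‖e T (i - 1)‖ ≤ (1 + ε) * θ T)
    (θmax θmin : ℝ)
    (hθmax : θmax = (1 + ε) * Finset.univ.sup' Finset.univ_nonempty θ)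
    (hθmin : θmin = Finset.univ.inf' Finset.univ_nonempty θ)
    (γ' : ι → ℝ) (hγ' : ∀ T, γ' T = ‖e T ℓ - e T L‖ / ‖e T L‖) :
    (Finset.univ.sup' Finset.univ_nonempty γ') /
        (Finset.univ.inf' Finset.univ_nonempty γ') ≤
      ((θmin ^ j)⁻¹ + 1) / ((θmax ^ j)⁻¹ - 1) := by
  obtain ⟨S, -, hS⟩ := Finset.exists_mem_eq_sup' Finset.univ_nonempty θ
  obtain ⟨R, -, hR⟩ := Finset.exists_mem_eq_inf' Finset.univ_nonempty θ
  have hmin_pos : 0 < θmin := by rw [hθmin, hR]; exact hθ R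
  have hmax_pos : 0 < θmax := by rw [hθmax, hS]; have := hθ S; positivity
  have hmax_lt : θmax < 1 := by rw [hθmax, hS]; exact hθε S
  have hmin_le (T : ι) : θmin ≤ θ T := hθmin ▸ Finset.inf'_le θ (Finset.mem_univ T)
  have hle_max (T : ι) : (1 + ε) * θ T ≤ θmax := by
    rw [hθmax]
    gcongr
    exact Finset.le_sup' θ (Finset.mem_univ T)
  have hbounds (T : ι) : γ' T ∈ Set.Icc ((θmax ^ j)⁻¹ - 1) ((θmin ^ j)⁻¹ + 1) := by
    have hlast : e T (ℓ + j) ≠ 0 := by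
      have h := (hθ T).trans_le (hconv T (ℓ + j) (by omega) (by omega)).2.1
      intro h0
      simp [h0] at h
    have hstep (k : ℕ) (hk : k < j) :
        θmin * ‖e T (ℓ + k)‖ ≤ ‖e T (ℓ + (k + 1))‖ ∧
          ‖e T (ℓ + (k + 1))‖ ≤ θmax * ‖e T (ℓ + k)‖ := by
      obtain ⟨hne, hl, hu⟩ := hconv T (ℓ + (k + 1)) (by omega) (by omega)
      rw [show ℓ + (k + 1) - 1 = ℓ + k by omega] at hne hl hu
      have hpos := norm_pos_iff.mpr hne
      exact ⟨(le_div_iff₀ hpos).mp ((hmin_le T).trans hl),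
        (div_le_iff₀ hpos).mp (hu.trans (hle_max T))⟩
    rw [hγ', show L = ℓ + j by omega]
    exact norm_sub_div_norm_mem_Icc_of_ratio_bounds (u := fun k => e T (ℓ + k)) hmin_pos hmax_pos
      hlast (fun k hk => (hstep k hk).1) (fun k hk => (hstep k hk).2)
  have hden : 0 < (θmax ^ j)⁻¹ - 1 :=
    sub_pos.mpr <| (one_lt_inv₀ (by positivity)).mpr <|
      pow_lt_one₀ hmax_pos.le hmax_lt (by omega)
  exact div_le_div₀ (by positivity) (Finset.sup'_le _ _ fun T _ => (hbounds T).2) hden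
    (Finset.le_inf' _ _ fun T _ => (hbounds T).1)
end

section
/- For ε = 0 and fixed θ ∈ (0,1), both effectivity constants approach one as the level offset j tends to infinity: the sequences j ↦ (1 − θ^j)^(j+1) / (1 + θ^(j+1))^j and j ↦ (1 + θ^j)^(j+1) / (1 − θ^(j+1))^j both converge to 1 as j → ∞. -/
/-- The powers `(1 + c * r ^ n) ^ n` tend to one: the base approaches one geometrically. -/
theorem tendsto_one_add_const_mul_pow_pow {r : ℝ} (hr : 0 ≤ r) (hr' : r < 1) (c : ℝ) :
    Filter.Tendsto (fun n : ℕ => (1 + c * r ^ n) ^ n) Filter.atTop (nhds 1) := by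
  have h : Filter.Tendsto (fun n : ℕ => (n : ℝ) * (c * r ^ n)) Filter.atTop (nhds 0) := by
    simpa [mul_left_comm] using (tendsto_self_mul_const_pow_of_lt_one hr hr').const_mul c
  simpa using Real.tendsto_one_add_pow_exp_of_tendsto h

/-- The common form of both effectivity constants, with `c = -1` and `c = 1`. -/
theorem tendsto_one_add_pow_succ_div_one_sub_pow {r : ℝ} (hr : 0 ≤ r) (hr' : r < 1) (c : ℝ) :
    Filter.Tendsto (fun n : ℕ => (1 + c * r ^ n) ^ (n + 1) / (1 - c * r ^ (n + 1)) ^ n)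
      Filter.atTop (nhds 1) := by
  have hbase : Filter.Tendsto (fun n : ℕ => 1 + c * r ^ n) Filter.atTop (nhds 1) := by
    simpa using ((tendsto_pow_atTop_nhds_zero_of_lt_one hr hr').const_mul c).const_add 1
  have hnum := (tendsto_one_add_const_mul_pow_pow hr hr' c).mul hbase
  have hden := tendsto_one_add_const_mul_pow_pow hr hr' (-(c * r))
  have hdiv := hnum.div hden one_ne_zero
  rw [mul_one, div_one] at hdiv
  refine hdiv.congr fun n => ?_
  have hn : 1 + -(c * r) * r ^ n = 1 - c * r ^ (n + 1) := by ring
  simp only [Pi.div_apply, hn, pow_succ (1 + c * r ^ n)]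


/-- For `ε = 0` and fixed `θ ∈ (0,1)`, both effectivity constants `C₁` and `C₂`
approach one as the level offset `j` tends to infinity. -/
theorem effectivity_constants_tendsto_one (θ : ℝ) (h0 : 0 < θ) (h1 : θ < 1) :
    Filter.Tendsto (fun j : ℕ => (1 - θ ^ j) ^ (j + 1) / (1 + θ ^ (j + 1)) ^ j)
        Filter.atTop (nhds 1) ∧
      Filter.Tendsto (fun j : ℕ => (1 + θ ^ j) ^ (j + 1) / (1 - θ ^ (j + 1)) ^ j)
        Filter.atTop (nhds 1) := by
  constructor
  · simpa [← sub_eq_add_neg] using tendsto_one_add_pow_succ_div_one_sub_pow h0.le h1 (-1)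
  · simpa using tendsto_one_add_pow_succ_div_one_sub_pow h0.le h1 1
end

section
/- (Coarse-grid grading condition implies fine-grid grading on all levels.) Let h, H, r be positive reals and ℓ ≤ L natural numbers. Suppose r − ((1 − 2^(−L))/2)·h ≥ 0 and h ≤ H · (r − ((1 − 2^(−L))/2)·h)^(1/3). Then, with h_ℓ := 2^(−ℓ)·h and r_ℓ := r − h/2 + h_ℓ/2, one has h_ℓ ≤ H · r_ℓ^(1/3). -/
/-- Coarse-grid grading condition implies fine-grid grading on all levels:
if `h ≤ H * (r - ((1 - 2^(-L))/2) * h)^(1/3)`, then for every `ℓ ≤ L` the refined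
mesh width `h_ℓ = 2^(-ℓ) * h` and distance `r_ℓ = r - h/2 + h_ℓ/2` satisfy
`h_ℓ ≤ H * r_ℓ^(1/3)`. -/
theorem coarse_grading_implies_fine_grading (h H r : ℝ)
    (hh : 0 < h) (hH : 0 < H) (hr : 0 < r)
    (L ℓ : ℕ) (hℓL : ℓ ≤ L)
    (hnn : 0 ≤ r - ((1 - ((2 : ℝ) ^ L)⁻¹) / 2) * h)
    (hgrade : h ≤ H * (r - ((1 - ((2 : ℝ) ^ L)⁻¹) / 2) * h) ^ ((1 : ℝ) / 3)) :
    ((2 : ℝ) ^ ℓ)⁻¹ * h ≤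
      H * (r - h / 2 + ((2 : ℝ) ^ ℓ)⁻¹ * h / 2) ^ ((1 : ℝ) / 3) := by
  have h_inv : ((2 : ℝ) ^ L)⁻¹ ≤ ((2 : ℝ) ^ ℓ)⁻¹ :=
    inv_anti₀ (by positivity) (pow_le_pow_right₀ one_le_two hℓL)
  have h_dist : r - ((1 - ((2 : ℝ) ^ L)⁻¹) / 2) * h ≤
      r - h / 2 + ((2 : ℝ) ^ ℓ)⁻¹ * h / 2 := by
    linarith [mul_le_mul_of_nonneg_right h_inv hh.le]
  calc ((2 : ℝ) ^ ℓ)⁻¹ * h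
      ≤ h := mul_le_of_le_one_left hh.le (inv_le_one_of_one_le₀ (one_le_pow₀ one_le_two))
    _ ≤ H * (r - ((1 - ((2 : ℝ) ^ L)⁻¹) / 2) * h) ^ ((1 : ℝ) / 3) := hgrade
    _ ≤ H * (r - h / 2 + ((2 : ℝ) ^ ℓ)⁻¹ * h / 2) ^ ((1 : ℝ) / 3) :=
      mul_le_mul_of_nonneg_left (Real.rpow_le_rpow hnn h_dist (by norm_num)) hH.le
end
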